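/- (Deterministic core of Theorem 3.2.) Under hypotheses (i)–(iv) of the inexact anchored iteration, the Bellman residual of the final iterate satisfies sp(𝒯(Q^n) − Q^n) ≤ 8·sp(Q^0 − Q^*)/(n+2) + 4·ε. -/

import Mathlib

open Finset

/-- Span seminorm: `sp x = max x − min x` on a nonempty finite index set. -/
noncomputable def sp {J : Type*} [Fintype J] [Nonempty J] (x : J → ℝ) : ℝ :=
  (univ.sup' univ_nonempty x) - (univ.inf' univ_nonempty x)

/-- Sup norm `‖x‖_∞ = max_j |x j|` on a nonempty finite index set. -/
noncomputable def supNorm {J : Type*} [Fintype J] [Nonempty J] (x : J → ℝ) : ℝ :=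
  univ.sup' univ_nonempty (fun j => |x j|)

/-- `P` is a transition kernel: nonnegative entries, each row sums to one. -/
def IsKernel {S A : Type*} [Fintype S] (P : S → A → S → ℝ) : Prop :=
  (∀ s a s', 0 ≤ P s a s') ∧ (∀ s a, ∑ s', P s a s' = 1)

/-- The Bellman operator `𝒯(Q)(s,a) = r(s,a) + ∑_{s'} P(s'|s,a)·max_{a'} Q(s',a')`. -/
noncomputable def bellman {S A : Type*} [Fintype S] [Fintype A] [Nonempty A]
    (P : S → A → S → ℝ) (r : S → A → ℝ) (Q : S × A → ℝ) : S × A → ℝ :=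
  fun p => r p.1 p.2 + ∑ s', P p.1 p.2 s' * (univ.sup' univ_nonempty (fun a' => Q (s', a')))

/-- The anchoring coefficients `β_k = k/(k+2)`. -/
noncomputable def beta (k : ℕ) : ℝ := (k : ℝ) / ((k : ℝ) + 2)

section SpanSeminorm

variable {J : Type*} [Fintype J] [Nonempty J]

lemma sub_le_sp (x : J → ℝ) (i j : J) : x i - x j ≤ sp x :=
  sub_le_sub (le_sup' x (mem_univ i)) (inf'_le x (mem_univ j))

lemma sp_le_iff {x : J → ℝ} {c : ℝ} : sp x ≤ c ↔ ∀ i j, x i - x j ≤ c := by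
  refine ⟨fun h i j => (sub_le_sp x i j).trans h, fun h => ?_⟩
  obtain ⟨i, -, hi⟩ := exists_mem_eq_sup' univ_nonempty x
  obtain ⟨j, -, hj⟩ := exists_mem_eq_inf' univ_nonempty x
  rw [sp, hi, hj]
  exact h i j

lemma sp_nonneg (x : J → ℝ) : 0 ≤ sp x := by
  obtain ⟨i⟩ := ‹Nonempty J›
  simpa using sub_le_sp x i i

lemma sp_le_mul_add_mul {x y z : J → ℝ} {a b : ℝ} (ha : 0 ≤ a) (hb : 0 ≤ b)
    (h : ∀ p, x p = a * y p + b * z p) : sp x ≤ a * sp y + b * sp z := by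
  refine sp_le_iff.2 fun i j => ?_
  have hy := mul_le_mul_of_nonneg_left (sub_le_sp y i j) ha
  have hz := mul_le_mul_of_nonneg_left (sub_le_sp z i j) hb
  rw [h, h]
  linarith

lemma sp_le_add {x y z : J → ℝ} (h : ∀ p, x p = y p + z p) : sp x ≤ sp y + sp z := by
  simpa using sp_le_mul_add_mul zero_le_one zero_le_one (by simpa using h)

lemma sp_sub_comm (x y : J → ℝ) : sp (fun p => x p - y p) = sp (fun p => y p - x p) := by
  have key (u v : J → ℝ) : sp (fun p => u p - v p) ≤ sp (fun p => v p - u p) :=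
    sp_le_iff.2 fun i j => by linarith [sub_le_sp (fun p => v p - u p) j i]
  exact (key x y).antisymm (key y x)

lemma sp_le_two_mul_supNorm (x : J → ℝ) : sp x ≤ 2 * supNorm x := by
  refine sp_le_iff.2 fun i j => ?_
  have h (k : J) : |x k| ≤ supNorm x := le_sup' (fun k => |x k|) (mem_univ k)
  linarith [h i, h j, le_abs_self (x i), neg_abs_le (x j)]

end SpanSeminorm

section Bellman

variable {S A : Type*} [Fintype S] [Fintype A] [Nonempty A] {P : S → A → S → ℝ}

lemma bellman_le_add_const (hP : IsKernel P) (r : S → A → ℝ) {Q Q' : S × A → ℝ} {c : ℝ}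
    (h : ∀ p, Q p ≤ Q' p + c) (p : S × A) : bellman P r Q p ≤ bellman P r Q' p + c := by
  have hmax (s : S) : univ.sup' univ_nonempty (fun a => Q (s, a)) ≤
      univ.sup' univ_nonempty (fun a => Q' (s, a)) + c :=
    sup'_le _ _ fun a ha => (h (s, a)).trans
      (add_le_add_left (le_sup' (fun a => Q' (s, a)) ha) c)
  have hsum := sum_le_sum fun s (_ : s ∈ univ) =>
    mul_le_mul_of_nonneg_left (hmax s) (hP.1 p.1 p.2 s)
  simp only [mul_add, sum_add_distrib, ← sum_mul, hP.2, one_mul] at hsum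
  simp only [bellman]
  linarith

lemma sp_bellman_sub_le [Nonempty S] (hP : IsKernel P) (r : S → A → ℝ) (Q Q' : S × A → ℝ) :
    sp (fun p => bellman P r Q p - bellman P r Q' p) ≤ sp (fun p => Q p - Q' p) := by
  obtain ⟨i, -, hi⟩ := exists_max_image univ (fun p => Q p - Q' p) univ_nonempty
  obtain ⟨j, -, hj⟩ := exists_min_image univ (fun p => Q p - Q' p) univ_nonempty
  refine sp_le_iff.2 fun p q => ?_
  have hp := bellman_le_add_const hP r (Q := Q) (Q' := Q') (c := Q i - Q' i)
    (fun x => by linarith [hi x (mem_univ x)]) p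
  have hq := bellman_le_add_const hP r (Q := Q') (Q' := Q) (c := -(Q j - Q' j))
    (fun x => by linarith [hj x (mem_univ x)]) q
  linarith [sub_le_sp (fun p => Q p - Q' p) i j]

lemma sp_approx_bellman_sub_fixed_le [Nonempty S] (hP : IsKernel P) {r : S → A → ℝ} {ε g : ℝ}
    {Q T Qstar : S × A → ℝ} (hT : supNorm (fun p => T p - bellman P r Q p) ≤ ε)
    (hstar : bellman P r Qstar = fun p => Qstar p + g) :
    sp (fun p => T p - Qstar p) ≤ sp (fun p => Q p - Qstar p) + 2 * ε := by
  have herr := sp_le_two_mul_supNorm (fun p => T p - bellman P r Q p)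
  have hcontr := sp_bellman_sub_le hP r Q Qstar
  rw [hstar] at hcontr
  refine sp_le_iff.2 fun i j => ?_
  have h₁ := sub_le_sp (fun p => T p - bellman P r Q p) i j
  have h₂ := sub_le_sp (fun p => bellman P r Q p - (Qstar p + g)) i j
  linarith

end Bellman

section AnchoredIteration

variable {J : Type*} [Fintype J] [Nonempty J]

lemma beta_succ (k : ℕ) : beta (k + 1) = ((k : ℝ) + 1) / (k + 3) := by
  simp only [beta]
  push_cast
  ring

lemma one_sub_beta_succ (k : ℕ) : 1 - beta (k + 1) = 2 / ((k : ℝ) + 3) := by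
  rw [beta_succ]
  field_simp
  ring

variable {n : ℕ} {ε : ℝ} {Q T : ℕ → J → ℝ} {Qstar : J → ℝ}

lemma sp_anchored_sub_fixed_le
    (hQ : ∀ k, k + 1 ≤ n →
      ∀ p, Q (k + 1) p = (1 - beta (k + 1)) * Q 0 p + beta (k + 1) * T k p)
    (hT : ∀ k, k ≤ n →
      sp (fun p => T k p - Qstar p) ≤ sp (fun p => Q k p - Qstar p) + 2 * ε)
    {k : ℕ} (hk : k ≤ n) :
    sp (fun p => Q k p - Qstar p) ≤ sp (fun p => Q 0 p - Qstar p) + 2 * ε * k / 3 := by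
  induction k with
  | zero => simp
  | succ k ih =>
    have hstep : sp (fun p => Q (k + 1) p - Qstar p) ≤
        2 / ((k : ℝ) + 3) * sp (fun p => Q 0 p - Qstar p) +
          ((k : ℝ) + 1) / (k + 3) * sp (fun p => T k p - Qstar p) := by
      rw [← one_sub_beta_succ, ← beta_succ]
      refine sp_le_mul_add_mul ?_ ?_ fun p => ?_
      · rw [one_sub_beta_succ]; positivity
      · rw [beta_succ]; positivity
      · rw [hQ k hk]; ring
    have hTk := (hT k (by omega)).trans (add_le_add_left (ih (by omega)) _)
    calc _ ≤ _ := hstep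
      _ ≤ _ := add_le_add_right (mul_le_mul_of_nonneg_left hTk (by positivity)) _
      _ = _ := by
        push_cast
        field_simp
        ring

lemma sp_approx_sub_anchor_le
    (hQ : ∀ k, k + 1 ≤ n →
      ∀ p, Q (k + 1) p = (1 - beta (k + 1)) * Q 0 p + beta (k + 1) * T k p)
    (hT : ∀ k, k ≤ n →
      sp (fun p => T k p - Qstar p) ≤ sp (fun p => Q k p - Qstar p) + 2 * ε)
    {k : ℕ} (hk : k ≤ n) :
    sp (fun p => T k p - Q 0 p) ≤
      2 * sp (fun p => Q 0 p - Qstar p) + 2 * ε * ((k : ℝ) + 3) / 3 := by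
  have htri : sp (fun p => T k p - Q 0 p) ≤
      sp (fun p => T k p - Qstar p) + sp (fun p => Qstar p - Q 0 p) :=
    sp_le_add fun p => by ring
  rw [sp_sub_comm Qstar] at htri
  linarith [hT k hk, sp_anchored_sub_fixed_le hQ hT hk]

lemma sp_anchored_succ_sub_le
    (hQ : ∀ k, k + 1 ≤ n →
      ∀ p, Q (k + 1) p = (1 - beta (k + 1)) * Q 0 p + beta (k + 1) * T k p)
    (hT : ∀ k, k ≤ n →
      sp (fun p => T k p - Qstar p) ≤ sp (fun p => Q k p - Qstar p) + 2 * ε)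
    (hTQ : ∀ k, k + 1 ≤ n →
      sp (fun p => T (k + 1) p - T k p) ≤ sp (fun p => Q (k + 1) p - Q k p))
    {k : ℕ} (hk : k + 1 ≤ n) :
    sp (fun p => Q (k + 1) p - Q k p) ≤
      4 * sp (fun p => Q 0 p - Qstar p) / ((k : ℝ) + 3) + 2 * ε / 3 := by
  have hD := sp_nonneg (fun p => Q 0 p - Qstar p)
  have hanchor := fun {k : ℕ} (hk : k ≤ n) => sp_approx_sub_anchor_le hQ hT hk
  set D := sp (fun p => Q 0 p - Qstar p)
  induction k with
  | zero =>
    have hstep : sp (fun p => Q (0 + 1) p - Q 0 p) ≤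
        1 / 3 * sp (fun p => T 0 p - Q 0 p) + 0 * sp (fun p => T 0 p - Q 0 p) := by
      refine sp_le_mul_add_mul (by norm_num) le_rfl fun p => ?_
      rw [hQ 0 hk, beta]
      push_cast
      ring
    have h₀ := hanchor (k := 0) (by omega)
    push_cast at h₀ ⊢
    linarith
  | succ k ih =>
    have hstep : sp (fun p => Q (k + 1 + 1) p - Q (k + 1) p) ≤
        2 / (((k : ℝ) + 3) * (k + 4)) * sp (fun p => T (k + 1) p - Q 0 p) +
          ((k : ℝ) + 1) / (k + 3) * sp (fun p => T (k + 1) p - T k p) := by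
      refine sp_le_mul_add_mul (by positivity) (by positivity) fun p => ?_
      rw [hQ (k + 1) hk, hQ k (by omega), one_sub_beta_succ, one_sub_beta_succ, beta_succ,
        beta_succ]
      push_cast
      field_simp
      ring
    have hdiff := (hTQ k (by omega)).trans (ih (by omega))
    calc _ ≤ _ := hstep
      _ ≤ _ := add_le_add (mul_le_mul_of_nonneg_left (hanchor (by omega)) (by positivity))
        (mul_le_mul_of_nonneg_left hdiff (by positivity))
      _ = 4 * D / (k + 4) + 2 * ε / 3 - 8 * D / (((k : ℝ) + 3) ^ 2 * (k + 4)) := by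
        push_cast
        field_simp
        ring
      _ ≤ 4 * D / (k + 4) + 2 * ε / 3 := sub_le_self _ (by positivity)
      _ = _ := by
        push_cast
        ring

lemma sp_approx_sub_anchored_le
    (hQ : ∀ k, k + 1 ≤ n →
      ∀ p, Q (k + 1) p = (1 - beta (k + 1)) * Q 0 p + beta (k + 1) * T k p)
    (hT : ∀ k, k ≤ n →
      sp (fun p => T k p - Qstar p) ≤ sp (fun p => Q k p - Qstar p) + 2 * ε)
    (hTQ : ∀ k, k + 1 ≤ n →
      sp (fun p => T (k + 1) p - T k p) ≤ sp (fun p => Q (k + 1) p - Q k p)) :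
    sp (fun p => T n p - Q n p) ≤
      8 * sp (fun p => Q 0 p - Qstar p) / ((n : ℝ) + 2) + 2 * ε := by
  have hD := sp_nonneg (fun p => Q 0 p - Qstar p)
  cases n with
  | zero =>
    have h₀ := sp_approx_sub_anchor_le hQ hT le_rfl
    push_cast at h₀ ⊢
    linarith
  | succ k =>
    have hstep : sp (fun p => T (k + 1) p - Q (k + 1) p) ≤
        1 * sp (fun p => T (k + 1) p - T k p) +
          2 / ((k : ℝ) + 3) * sp (fun p => T k p - Q 0 p) := by
      refine sp_le_mul_add_mul zero_le_one (by positivity) fun p => ?_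
      rw [hQ k le_rfl, one_sub_beta_succ, beta_succ]
      field_simp
      ring
    have hdiff := (hTQ k le_rfl).trans (sp_anchored_succ_sub_le hQ hT hTQ le_rfl)
    have hanchor := sp_approx_sub_anchor_le hQ hT k.le_succ
    calc _ ≤ _ := hstep
      _ ≤ _ := add_le_add (mul_le_mul_of_nonneg_left hdiff zero_le_one)
        (mul_le_mul_of_nonneg_left hanchor (by positivity))
      _ = _ := by
        push_cast
        field_simp
        ring

end AnchoredIteration

/-- Deterministic core of Theorem 3.2: under the inexact anchored iteration hypotheses
(i)–(iv), `sp(𝒯(Q^n) − Q^n) ≤ 8·sp(Q^0 − Q^*)/(n+2) + 4·ε`. -/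
theorem savia_residual_bound

    {S A : Type*} [Fintype S] [Nonempty S] [Fintype A] [Nonempty A]
    (P : S → A → S → ℝ) (hP : IsKernel P) (r : S → A → ℝ)
    (ε : ℝ) (hε : 0 ≤ ε) (n : ℕ)
    (Q T : ℕ → S × A → ℝ) (Qstar : S × A → ℝ) (gstar : ℝ)
    (h1 : ∀ k, 1 ≤ k → k ≤ n →
      Q k = fun p => (1 - beta k) * Q 0 p + beta k * T (k - 1) p)
    (h2 : ∀ k, k ≤ n → supNorm (fun p => T k p - bellman P r (Q k) p) ≤ ε)
    (h3 : bellman P r Qstar = fun p => Qstar p + gstar)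
    (h4 : ∀ k, 1 ≤ k → k ≤ n →
      sp (fun p => T k p - T (k - 1) p) ≤ sp (fun p => Q k p - Q (k - 1) p))
    :
    sp (fun p => bellman P r (Q n) p - Q n p)
      ≤ 8 * sp (fun p => Q 0 p - Qstar p) / ((n : ℝ) + 2) + 4 * ε := by
  have hbound := sp_approx_sub_anchored_le (n := n) (T := T) (Qstar := Qstar)
    (fun k hk p => congrFun (h1 (k + 1) (by omega) hk) p)
    (fun k hk => sp_approx_bellman_sub_fixed_le hP (h2 k hk) h3)
    (fun k hk => h4 (k + 1) (by omega) hk)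
  have htri : sp (fun p => bellman P r (Q n) p - Q n p) ≤
      sp (fun p => bellman P r (Q n) p - T n p) + sp (fun p => T n p - Q n p) :=
    sp_le_add fun p => by ring
  rw [sp_sub_comm (bellman P r (Q n)) (T n)] at htri
  linarith [h2 n le_rfl, sp_le_two_mul_supNorm (fun p => T n p - bellman P r (Q n) p)]
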